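/- Suppose p ∈ (0,1] and q ∈ [0,1) satisfy max{p, 1−q} ≥ θ/n for a constant θ > 0. Consider the simple load-balancing algorithm on an edge-Markovian evolving graph with parameters p, q, in which at each step t the matching M_t is generated by choosing a vertex v ∈ V uniformly at random and, if v has a neighbor in G_t, choosing a neighbor u of v uniformly at random and setting M_t = {{v,u}} (otherwise M_t = ∅). Then there exists a constant C > 0 such that for any initial configuration Γ_0, with probability at least 1 − 1/n the balancing time satisfies T_bal ≤ C·r·n·log(Δ·n), where r = max{p/(1−q), (1−q)/p}. -/

import Mathlib

open Finset

noncomputable section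

/-- Rounding a real number to the nearest integer, ties rounded up: `⌈x⌋ := ⌈x - 1/2⌉`. -/
def roundNear (x : ℝ) : ℤ := ⌈x - 1 / 2⌉

/-- The degree of a vertex in a simple graph (stated without decidability assumptions). -/
def gdeg {V : Type} (G : SimpleGraph V) (v : V) : ℕ := Nat.card {u : V // G.Adj v u}

/-- The initial discrepancy `Δ = max Γ₀ - min Γ₀` of a load configuration. -/
def disc {V : Type} [Fintype V] [Nonempty V] (Γ₀ : V → ℕ) : ℕ :=
  Finset.univ.sup Γ₀ - Finset.univ.inf' Finset.univ_nonempty Γ₀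

/-- An execution of a random matching load-balancing algorithm on an edge-Markovian
evolving graph with parameters `p, q` on the vertex set `V`:
* `G t` is the (random) graph at time `t`, `M t` the random matching chosen at time `t`,
  and `Γ t` the load configuration at time `t`;
* `hist t` is the σ-algebra of events determined by the history
  `Γ_0, G_0, M_0, Γ_1, …, G_{t-1}, M_{t-1}, Γ_t` of the execution up to time `t`;
* conditionally on any (positive-probability) event determined by the history up to time `t+1`
  which determines `G t = H`, every non-edge of `H` becomes an edge of `G (t+1)` with
  probability `p`, every edge of `H` disappears with probability `q`, independently over pairs;
* for every matched pair `{v,u}` of `M t`, the loads are rebalanced to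
  `(⌈(Γ t v + Γ t u)/2⌉, ⌊(Γ t v + Γ t u)/2⌋)` or the transposed pair (each with
  probability `1/2`, which only matters when `Γ t v + Γ t u` is odd), while
  unmatched vertices keep their loads. -/
structure EMLoadProcess (V : Type) [Fintype V] [DecidableEq V] where
  Ω : Type
  [mΩ : MeasurableSpace Ω]
  μ : MeasureTheory.Measure Ω
  isProb : MeasureTheory.IsProbabilityMeasure μ
  p : ℝ
  q : ℝ
  p_pos : 0 < p
  p_le_one : p ≤ 1
  q_nonneg : 0 ≤ q
  q_lt_one : q < 1
  G : ℕ → Ω → SimpleGraph V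
  M : ℕ → Ω → Set (Sym2 V)
  Γ : ℕ → Ω → V → ℕ
  hist : ℕ → MeasurableSpace Ω
  hist_le : ∀ t, hist t ≤ mΩ
  hist_mono : Monotone hist
  meas_Γ : ∀ t, @Measurable Ω (V → ℕ) (hist t) ⊤ (Γ t)
  meas_G : ∀ t, @Measurable Ω (SimpleGraph V) (hist (t + 1)) ⊤ (G t)
  meas_M : ∀ t, @Measurable Ω (Set (Sym2 V)) (hist (t + 1)) ⊤ (M t)
  M_sub : ∀ t ω, M t ω ⊆ (G t ω).edgeSet
  M_matching : ∀ t ω, ∀ e ∈ M t ω, ∀ f ∈ M t ω, ∀ x : V, x ∈ e → x ∈ f → e = f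
  unmatched : ∀ t ω v, (∀ u : V, s(v, u) ∉ M t ω) → Γ (t + 1) ω v = Γ t ω v
  matched : ∀ t ω v u, s(v, u) ∈ M t ω →
    (Γ (t + 1) ω v = (Γ t ω v + Γ t ω u + 1) / 2 ∧ Γ (t + 1) ω u = (Γ t ω v + Γ t ω u) / 2) ∨
    (Γ (t + 1) ω v = (Γ t ω v + Γ t ω u) / 2 ∧ Γ (t + 1) ω u = (Γ t ω v + Γ t ω u + 1) / 2)
  coin : ∀ (t : ℕ) (v u : V) (E : Set Ω),
    @MeasurableSet _ (hist t ⊔ MeasurableSpace.comap (G t) ⊤ ⊔ MeasurableSpace.comap (M t) ⊤) E →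
    μ E ≠ 0 → E ⊆ {ω | s(v, u) ∈ M t ω ∧ Odd (Γ t ω v + Γ t ω u)} →
    ProbabilityTheory.cond μ E {ω | Γ (t + 1) ω v = (Γ t ω v + Γ t ω u + 1) / 2} = 1 / 2
  markov_edge : ∀ (t : ℕ) (H : SimpleGraph V) (E : Set Ω), @MeasurableSet _ (hist (t + 1)) E →
    μ E ≠ 0 → E ⊆ {ω | G t ω = H} → ∀ e : Sym2 V, ¬e.IsDiag → e ∈ H.edgeSet →
    ProbabilityTheory.cond μ E {ω | e ∈ (G (t + 1) ω).edgeSet} = ENNReal.ofReal (1 - q)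
  markov_nonedge : ∀ (t : ℕ) (H : SimpleGraph V) (E : Set Ω), @MeasurableSet _ (hist (t + 1)) E →
    μ E ≠ 0 → E ⊆ {ω | G t ω = H} → ∀ e : Sym2 V, ¬e.IsDiag → e ∉ H.edgeSet →
    ProbabilityTheory.cond μ E {ω | e ∈ (G (t + 1) ω).edgeSet} = ENNReal.ofReal p
  markov_indep : ∀ (t : ℕ) (H : SimpleGraph V) (E : Set Ω), @MeasurableSet _ (hist (t + 1)) E →
    μ E ≠ 0 → E ⊆ {ω | G t ω = H} →
    ProbabilityTheory.iIndepSet (fun e : {e : Sym2 V // ¬e.IsDiag} => {ω | (e : Sym2 V) ∈ (G (t + 1) ω).edgeSet})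
      (ProbabilityTheory.cond μ E)

/-- The `F`-fair condition: conditionally on `G t = Gr` and any (positive-probability) event
determined by the history of the execution up to time `t`, every edge `{u,v}` of `Gr` is matched
with probability at least `F / max (deg u) (deg v)`. -/
def EMLoadProcess.Fair {V : Type} [Fintype V] [DecidableEq V]
    (P : EMLoadProcess V) (F : ℝ) : Prop :=
  ∀ (t : ℕ) (Gr : SimpleGraph V) (u v : V), Gr.Adj u v →
    ∀ E : Set P.Ω, @MeasurableSet _ (P.hist t) E →
      P.μ ({ω | P.G t ω = Gr} ∩ E) ≠ 0 →
      ENNReal.ofReal (F / (max (gdeg Gr u) (gdeg Gr v) : ℝ)) ≤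
        ProbabilityTheory.cond P.μ ({ω | P.G t ω = Gr} ∩ E) {ω | s(u, v) ∈ P.M t ω}

/-- The ratio `r := max{p/(1−q), (1−q)/p}` of an edge-Markovian evolving graph. -/
def EMLoadProcess.r {V : Type} [Fintype V] [DecidableEq V] (P : EMLoadProcess V) : ℝ :=
  max (P.p / (1 - P.q)) ((1 - P.q) / P.p)

/-- The average load `μ = (Σ_v Γ₀(v))/n` of a configuration `Γ₀`. -/
def avgLoad {V : Type} [Fintype V] (Γ₀ : V → ℕ) : ℝ :=
  (∑ v : V, (Γ₀ v : ℝ)) / (Fintype.card V : ℝ)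

/-- The simple load-balancing algorithm: at each step, the random matching consists of at
most one edge; conditionally on `G t = Gr` and any (positive-probability) event determined
by the history up to time `t`, the matching equals the single edge `{u,v}` of `Gr` with
probability `(1/n)·(1/deg u + 1/deg v)` (as obtained by choosing a uniformly random vertex
and then, if it has one, a uniformly random neighbor of it). -/
def EMLoadProcess.SimpleLB {V : Type} [Fintype V] [DecidableEq V]
    (P : EMLoadProcess V) : Prop :=
  (∀ (t : ℕ) (ω : P.Ω), (P.M t ω).Subsingleton) ∧
  ∀ (t : ℕ) (Gr : SimpleGraph V) (u v : V), Gr.Adj u v →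
    ∀ E : Set P.Ω, @MeasurableSet _ (P.hist t) E →
      P.μ ({ω | P.G t ω = Gr} ∩ E) ≠ 0 →
      ProbabilityTheory.cond P.μ ({ω | P.G t ω = Gr} ∩ E)
          {ω | P.M t ω = ({s(u, v)} : Set (Sym2 V))} =
        ENNReal.ofReal
          ((1 / (Fintype.card V : ℝ)) * (1 / (gdeg Gr u : ℝ) + 1 / (gdeg Gr v : ℝ)))

/-- The convex penalty `|x| (|x| - 1)` of a deviation `x`; it vanishes exactly when `|x| ≤ 1`. -/
def spread (x : ℤ) : ℤ := |x| * (|x| - 1)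

/-- The decrease of `spread x + spread y` when the loads `x` and `y` are balanced. -/
def spreadDrop (x y : ℤ) : ℤ :=
  spread x + spread y - spread ((x + y + 1) / 2) - spread ((x + y) / 2)

lemma spread_neg (x : ℤ) : spread (-x) = spread x := by simp [spread]

lemma spread_of_nonneg {x : ℤ} (hx : 0 ≤ x) : spread x = x * (x - 1) := by
  simp [spread, abs_of_nonneg hx]

lemma spread_of_nonpos {x : ℤ} (hx : x ≤ 0) : spread x = x * (x + 1) := by
  rw [spread, abs_of_nonpos hx]; ring

lemma spread_nonneg (x : ℤ) : 0 ≤ spread x := by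
  rcases le_total 0 x with h | h
  · rw [spread_of_nonneg h]
    rcases h.eq_or_lt with rfl | h
    · simp
    · nlinarith
  · rw [spread_of_nonpos h]
    rcases h.eq_or_lt with rfl | h
    · simp
    · nlinarith

lemma spread_eq_zero_iff (x : ℤ) : spread x = 0 ↔ |x| ≤ 1 := by
  have := abs_nonneg x
  simp only [spread, mul_eq_zero]
  omega

lemma spreadDrop_comm (x y : ℤ) : spreadDrop x y = spreadDrop y x := by
  simp only [spreadDrop, add_comm x y]; ring

lemma spreadDrop_neg (x y : ℤ) : spreadDrop (-x) (-y) = spreadDrop x y := by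
  have h1 : (-x + -y + 1) / 2 = -((x + y) / 2) := by omega
  have h2 : (-x + -y) / 2 = -((x + y + 1) / 2) := by omega
  simp only [spreadDrop, h1, h2, spread_neg]; ring

lemma le_spreadDrop_of_nonneg_of_nonpos {x y : ℤ} (hx : 0 ≤ x) (hy : y ≤ 0) :
    spread x + spread y ≤ 2 * spreadDrop x y := by
  wlog hxy : 0 ≤ x + y generalizing x y
  · have := @this (-y) (-x) (by omega) (by omega) (by omega)
    rwa [spreadDrop_neg, spread_neg, spread_neg, spreadDrop_comm, add_comm] at this
  obtain ⟨j, rfl⟩ : ∃ j, y = -j := ⟨-y, by ring⟩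
  have hj : 0 ≤ j := by omega
  simp only [spreadDrop]
  rw [spread_of_nonneg hx, spread_of_nonpos hy, spread_of_nonneg (by omega),
    spread_of_nonneg (by omega)]
  rcases Int.even_or_odd' (x + -j) with ⟨d, hd | hd⟩
  · have h1 : (x + -j + 1) / 2 = d := by omega
    have h2 : (x + -j) / 2 = d := by omega
    rw [h1, h2]
    obtain rfl : x = 2 * d + j := by omega
    have hd0 : 0 ≤ d := by omega
    rcases hj.eq_or_lt with rfl | hj
    · nlinarith
    · nlinarith [mul_nonneg hd0 hj.le]
  · have h1 : (x + -j + 1) / 2 = d + 1 := by omega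
    have h2 : (x + -j) / 2 = d := by omega
    rw [h1, h2]
    obtain rfl : x = 2 * d + 1 + j := by omega
    have hd0 : 0 ≤ d := by omega
    rcases hj.eq_or_lt with rfl | hj
    · nlinarith
    · nlinarith [mul_nonneg hd0 hj.le]

lemma le_spreadDrop_of_mul_nonpos {x y : ℤ} (h : x * y ≤ 0) :
    spread x + spread y ≤ 2 * spreadDrop x y := by
  rcases mul_nonpos_iff.1 h with ⟨hx, hy⟩ | ⟨hx, hy⟩
  · exact le_spreadDrop_of_nonneg_of_nonpos hx hy
  · rw [spreadDrop_comm, add_comm]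
    exact le_spreadDrop_of_nonneg_of_nonpos hy hx

lemma sq_le_two_mul_spread_add_one (x : ℤ) : x ^ 2 ≤ 2 * spread x + 1 := by
  rw [spread, ← sq_abs]
  rcases (abs_nonneg x).eq_or_lt with h | h
  · rw [← h]; norm_num
  · nlinarith

lemma spread_le_sq (x : ℤ) : spread x ≤ x ^ 2 := by
  rw [spread, ← sq_abs]
  nlinarith [abs_nonneg x]

lemma abs_le_half_spread_add_one (x : ℤ) : 2 * |x| ≤ spread x + 2 := by
  rw [spread]
  have := abs_nonneg x
  rcases (show |x| = 0 ∨ |x| = 1 ∨ 2 ≤ |x| by omega) with h | h | h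
  · rw [h]; norm_num
  · rw [h]; norm_num
  · nlinarith

lemma sq_sub_le_of_nonneg {x y : ℤ} (hx : 0 ≤ x) (hy : 0 ≤ y) :
    (x - y) ^ 2 ≤ 2 * spreadDrop x y + 1 := by
  simp only [spreadDrop]
  rw [spread_of_nonneg hx, spread_of_nonneg hy, spread_of_nonneg (by omega),
    spread_of_nonneg (by omega)]
  rcases Int.even_or_odd' (x + y) with ⟨d, hd | hd⟩
  · have h1 : (x + y + 1) / 2 = d := by omega
    have h2 : (x + y) / 2 = d := by omega
    rw [h1, h2]
    obtain rfl : x = 2 * d - y := by omega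
    nlinarith
  · have h1 : (x + y + 1) / 2 = d + 1 := by omega
    have h2 : (x + y) / 2 = d := by omega
    rw [h1, h2]
    obtain rfl : x = 2 * d + 1 - y := by omega
    nlinarith

lemma sq_sub_le_spreadDrop (x y : ℤ) : (x - y) ^ 2 ≤ 8 * spreadDrop x y + 4 := by
  have same {x y : ℤ} (hx : 0 ≤ x) (hy : 0 ≤ y) : (x - y) ^ 2 ≤ 8 * spreadDrop x y + 4 := by
    nlinarith [sq_sub_le_of_nonneg hx hy, sq_nonneg (x - y)]
  have opp {x y : ℤ} (h : x * y ≤ 0) : (x - y) ^ 2 ≤ 8 * spreadDrop x y + 4 := by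
    nlinarith [le_spreadDrop_of_mul_nonpos h, sq_le_two_mul_spread_add_one x,
      sq_le_two_mul_spread_add_one y, sq_nonneg (x + y)]
  rcases le_total 0 x with hx | hx <;> rcases le_total 0 y with hy | hy
  · exact same hx hy
  · exact opp (mul_nonpos_of_nonneg_of_nonpos hx hy)
  · exact opp (mul_nonpos_of_nonpos_of_nonneg hx hy)
  · have := @same (-x) (-y) (by omega) (by omega)
    rw [spreadDrop_neg] at this
    linarith [this, (by ring : (-x - -y) ^ 2 = (x - y) ^ 2)]

lemma spreadDrop_nonneg (x y : ℤ) : 0 ≤ spreadDrop x y := by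
  nlinarith [sq_sub_le_spreadDrop x y, sq_nonneg (x - y)]

lemma spreadDrop_self (x : ℤ) : spreadDrop x x = 0 := by
  have h1 : (x + x + 1) / 2 = x := by omega
  have h2 : (x + x) / 2 = x := by omega
  simp [spreadDrop, h1, h2]

/-- The decrease of the total spread when the vertices `u` and `v` are balanced. -/
def pairDrop {V : Type*} (m : ℤ) (γ : V → ℕ) (u v : V) : ℤ := spreadDrop (γ u - m) (γ v - m)

lemma pairDrop_nonneg {V : Type*} (m : ℤ) (γ : V → ℕ) (u v : V) : 0 ≤ pairDrop m γ u v :=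
  spreadDrop_nonneg _ _

section Configuration

variable {V : Type*} [Fintype V]

lemma sum_sum_sq_sub (x : V → ℤ) :
    ∑ u, ∑ v, (x u - x v) ^ 2 = 2 * Fintype.card V * ∑ v, x v ^ 2 - 2 * (∑ v, x v) ^ 2 := by
  have h (u v : V) : (x u - x v) ^ 2 = x u ^ 2 + x v ^ 2 - 2 * (x u * x v) := by ring
  simp only [h, sum_sub_distrib, sum_add_distrib, sum_const, card_univ, nsmul_eq_mul, ← mul_sum,
    ← sum_mul]
  ring

lemma card_mul_sum_spread_le_of_large (x : V → ℤ) (hx : |2 * ∑ v, x v| ≤ Fintype.card V)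
    (hlarge : 3 * (Fintype.card V : ℤ) ≤ ∑ v, spread (x v)) :
    Fintype.card V * ∑ v, spread (x v) ≤ 16 * ∑ u, ∑ v, spreadDrop (x u) (x v) := by
  have h1 : ∑ u, ∑ v, (x u - x v) ^ 2 ≤ ∑ u, ∑ v, (8 * spreadDrop (x u) (x v) + 4) :=
    sum_le_sum fun u _ => sum_le_sum fun v _ => sq_sub_le_spreadDrop _ _
  have h2 : ∑ v, spread (x v) ≤ ∑ v, x v ^ 2 := sum_le_sum fun v _ => spread_le_sq _
  have h3 : (2 * ∑ v, x v) ^ 2 ≤ (Fintype.card V : ℤ) ^ 2 :=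
    sq_le_sq' (abs_le.1 hx).1 (abs_le.1 hx).2
  rw [sum_sum_sq_sub] at h1
  simp only [sum_add_distrib, sum_const, card_univ, nsmul_eq_mul, ← mul_sum] at h1
  have hn : (0 : ℤ) ≤ Fintype.card V := by positivity
  nlinarith [mul_le_mul_of_nonneg_left h2 hn, mul_le_mul_of_nonneg_left hlarge hn]

lemma sum_spread_mul_card_le (x : V → ℤ) :
    ∑ u, spread (x u) * #{v | x u * x v ≤ 0} ≤ ∑ u, ∑ v, spreadDrop (x u) (x v) := by
  have h1 : ∑ u, ∑ v, (if x u * x v ≤ 0 then spread (x u) + spread (x v) else 0) ≤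
      2 * ∑ u, ∑ v, spreadDrop (x u) (x v) := by
    simp only [mul_sum]
    refine sum_le_sum fun u _ => sum_le_sum fun v _ => ?_
    split_ifs with h
    · exact le_spreadDrop_of_mul_nonpos h
    · linarith [spreadDrop_nonneg (x u) (x v)]
  have h2 : ∑ u, ∑ v, (if x u * x v ≤ 0 then spread (x u) else 0) =
      ∑ u, spread (x u) * #{v | x u * x v ≤ 0} := by
    simp [← sum_filter, mul_comm]
  have h3 : ∑ u, ∑ v, (if x u * x v ≤ 0 then spread (x v) else 0) =
      ∑ u, spread (x u) * #{v | x u * x v ≤ 0} := by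
    rw [sum_comm, ← h2]
    simp only [mul_comm]
  have h4 : ∑ u, ∑ v, (if x u * x v ≤ 0 then spread (x u) + spread (x v) else 0) =
      ∑ u, ∑ v, (if x u * x v ≤ 0 then spread (x u) else 0) +
      ∑ u, ∑ v, (if x u * x v ≤ 0 then spread (x v) else 0) := by
    simp only [← sum_add_distrib]
    refine sum_congr rfl fun u _ => sum_congr rfl fun v _ => ?_
    split_ifs <;> simp
  linarith

lemma card_mul_sum_spread_le_of_few_nonpos (x : V → ℤ) (hx : 2 * ∑ v, x v ≤ Fintype.card V)
    (hsmall : ∑ v, spread (x v) ≤ 3 * (Fintype.card V : ℤ))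
    (hfew : 8 * #{v | x v ≤ 0} < Fintype.card V) :
    Fintype.card V * ∑ v, spread (x v) ≤ 16 * ∑ u, ∑ v, spreadDrop (x u) (x v) := by
  have hcard : #{v | x v ≤ 0} + #{v | ¬ x v ≤ 0} = Fintype.card V := by
    rw [card_filter_add_card_filter_not, card_univ]
  have hpos : ∑ v with x v ≤ 0, spread (x v) ≥
      (Fintype.card V : ℤ) - 4 * #{v | x v ≤ 0} := by
    have h1 : ∑ v with x v ≤ 0, (-spread (x v) - 2) ≤ ∑ v with x v ≤ 0, 2 * x v :=
      sum_le_sum fun v hv => by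
        have := abs_le_half_spread_add_one (x v)
        rw [abs_of_nonpos (mem_filter.1 hv).2] at this
        linarith
    have h2 : ∑ v with ¬ x v ≤ 0, (2 : ℤ) ≤ ∑ v with ¬ x v ≤ 0, 2 * x v :=
      sum_le_sum fun v hv => by have := (mem_filter.1 hv).2; omega
    have h3 := sum_filter_add_sum_filter_not univ (fun v => x v ≤ 0) (fun v => 2 * x v)
    rw [← mul_sum univ] at h3
    simp only [sum_sub_distrib, sum_neg_distrib, sum_const, nsmul_eq_mul] at h1 h2
    zify at hcard
    linarith
  have hcross : (∑ v with x v ≤ 0, spread (x v)) * #{v | ¬ x v ≤ 0} ≤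
      ∑ u, spread (x u) * #{v | x u * x v ≤ 0} := by
    rw [sum_mul]
    refine le_trans (sum_le_sum fun u hu => ?_) (sum_le_sum_of_subset_of_nonneg (subset_univ _)
      fun u _ _ => mul_nonneg (spread_nonneg _) (by positivity))
    refine mul_le_mul_of_nonneg_left ?_ (spread_nonneg _)
    exact_mod_cast card_le_card fun v hv => by
      simp only [mem_filter, mem_univ, true_and, not_le] at hu hv ⊢
      exact mul_nonpos_of_nonpos_of_nonneg hu hv.le
  have := hcross.trans (sum_spread_mul_card_le x)
  have hn : (0 : ℤ) ≤ Fintype.card V := by positivity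
  zify at hcard hfew
  have hF : (Fintype.card V : ℤ) ≤ 2 * ∑ v with x v ≤ 0, spread (x v) := by linarith
  have hb : 7 * (Fintype.card V : ℤ) ≤ 8 * #{v | ¬ x v ≤ 0} := by linarith
  have hprod : (7 * (Fintype.card V : ℤ)) * Fintype.card V ≤
      (8 * #{v | ¬ x v ≤ 0}) * (2 * ∑ v with x v ≤ 0, spread (x v)) :=
    mul_le_mul hb hF hn (by positivity)
  nlinarith [mul_le_mul_of_nonneg_left hsmall hn]

lemma card_mul_sum_spread_le (x : V → ℤ) (hx : |2 * ∑ v, x v| ≤ Fintype.card V) :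
    Fintype.card V * ∑ v, spread (x v) ≤ 16 * ∑ u, ∑ v, spreadDrop (x u) (x v) := by
  rcases le_total (3 * (Fintype.card V : ℤ)) (∑ v, spread (x v)) with hlarge | hsmall
  · exact card_mul_sum_spread_le_of_large x hx hlarge
  by_cases hnonpos : 8 * #{v | x v ≤ 0} < Fintype.card V
  · exact card_mul_sum_spread_le_of_few_nonpos x (abs_le.1 hx).2 hsmall hnonpos
  by_cases hnonneg : 8 * #{v | 0 ≤ x v} < Fintype.card V
  · have := card_mul_sum_spread_le_of_few_nonpos (fun v => -x v)
      (by rw [sum_neg_distrib]; linarith [(abs_le.1 hx).1])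
      (by simpa only [spread_neg] using hsmall) (by simpa using hnonneg)
    simpa only [spread_neg, spreadDrop_neg] using this
  push Not at hnonpos hnonneg
  have hle : ∑ u, Fintype.card V * spread (x u) ≤
      8 * ∑ u, spread (x u) * #{v | x u * x v ≤ 0} := by
    rw [mul_sum]
    refine sum_le_sum fun u _ => ?_
    have : (Fintype.card V : ℤ) ≤ 8 * #{v | x u * x v ≤ 0} := by
      rcases le_total 0 (x u) with hu | hu
      · exact_mod_cast hnonpos.trans (Nat.mul_le_mul_left 8 (card_le_card fun v hv => by
          simp only [mem_filter, mem_univ, true_and] at hv ⊢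
          exact mul_nonpos_of_nonneg_of_nonpos hu hv))
      · exact_mod_cast hnonneg.trans (Nat.mul_le_mul_left 8 (card_le_card fun v hv => by
          simp only [mem_filter, mem_univ, true_and] at hv ⊢
          exact mul_nonpos_of_nonpos_of_nonneg hu hv))
    nlinarith [spread_nonneg (x u)]
  rw [← mul_sum] at hle
  have h0 : 0 ≤ ∑ u, ∑ v, spreadDrop (x u) (x v) :=
    sum_nonneg fun u _ => sum_nonneg fun v _ => spreadDrop_nonneg _ _
  linarith [sum_spread_mul_card_le x]

/-- The total spread of a load configuration around the target load `m`. -/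
def totalSpread (m : ℤ) (γ : V → ℕ) : ℤ := ∑ v, spread (γ v - m)

lemma totalSpread_nonneg (m : ℤ) (γ : V → ℕ) : 0 ≤ totalSpread m γ :=
  sum_nonneg fun _ _ => spread_nonneg _

lemma pairDrop_le (m : ℤ) (γ : V → ℕ) (u v : V) : pairDrop m γ u v ≤ 2 * totalSpread m γ := by
  have h (w : V) : spread (γ w - m) ≤ totalSpread m γ :=
    single_le_sum (f := fun w => spread (γ w - m)) (fun _ _ => spread_nonneg _) (mem_univ w)
  have h1 := spread_nonneg ((γ u - m + (γ v - m) + 1) / 2)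
  have h2 := spread_nonneg ((γ u - m + (γ v - m)) / 2)
  unfold pairDrop spreadDrop
  linarith [h u, h v]

lemma totalSpread_eq_zero_iff (m : ℤ) (γ : V → ℕ) :
    totalSpread m γ = 0 ↔ ∀ v, |(γ v : ℤ) - m| ≤ 1 := by
  simp [totalSpread, sum_eq_zero_iff_of_nonneg fun _ _ => spread_nonneg _, spread_eq_zero_iff]

end Configuration

section Measure

open MeasureTheory ProbabilityTheory

variable {Ω : Type*} {mΩ : MeasurableSpace Ω} {μ : Measure Ω} [IsFiniteMeasure μ]

lemma measureReal_inter_eq_of_cond_eq {E A : Set Ω} (hE : MeasurableSet E) {c : ℝ} (hc : 0 ≤ c)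
    (h : μ E ≠ 0 → ProbabilityTheory.cond μ E A = ENNReal.ofReal c) :
    μ.real (E ∩ A) = c * μ.real E := by
  by_cases h0 : μ E = 0
  · simp [measureReal_def, h0, measure_mono_null Set.inter_subset_left h0]
  · rw [measureReal_def, ← cond_mul_eq_inter hE A μ, h h0, ENNReal.toReal_mul,
      ENNReal.toReal_ofReal hc, measureReal_def]

lemma measureReal_eq_sum_inter_fiber {ι : Type*} [Fintype ι] {g : Ω → ι}
    (hg : ∀ i, MeasurableSet (g ⁻¹' {i})) (E : Set Ω) :
    μ.real E = ∑ i, μ.real (E ∩ g ⁻¹' {i}) := by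
  have := sum_measureReal_preimage_singleton (μ := μ.restrict E) (f := g) univ fun i _ => hg i
  simp only [measureReal_restrict_apply (hg _), coe_univ, Set.preimage_univ,
    measureReal_restrict_apply MeasurableSet.univ, Set.univ_inter] at this
  rw [← this]
  simp only [Set.inter_comm]

lemma mul_measureReal_le_of_fiber {ι : Type*} [Finite ι] {g : Ω → ι}
    (hg : ∀ i, MeasurableSet (g ⁻¹' {i})) {A B : Set Ω} {c d : ℝ}
    (h : ∀ i, c * μ.real (A ∩ g ⁻¹' {i}) ≤ d * μ.real (B ∩ g ⁻¹' {i})) :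
    c * μ.real A ≤ d * μ.real B := by
  have := Fintype.ofFinite ι
  rw [measureReal_eq_sum_inter_fiber hg A, measureReal_eq_sum_inter_fiber hg B, mul_sum, mul_sum]
  exact sum_le_sum fun i _ => h i

lemma mul_integral_le_setIntegral {m : MeasurableSpace Ω} (hm : m ≤ mΩ) {A : Set Ω}
    {c : ℝ} (hc : 0 ≤ c)
    (h : ∀ E, MeasurableSet[m] E → c * μ.real E ≤ μ.real (E ∩ A)) {f : Ω → ℝ}
    (hf : StronglyMeasurable[m] f) (hf0 : 0 ≤ f) (h_int : Integrable f μ) :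
    c * ∫ ω, f ω ∂μ ≤ ∫ ω in A, f ω ∂μ := by
  have hle : ENNReal.ofReal c • μ.trim hm ≤ (μ.restrict A).trim hm := by
    refine Measure.le_iff.2 fun E hE => ?_
    rw [Measure.smul_apply, trim_measurableSet_eq hm hE, trim_measurableSet_eq hm hE,
      Measure.restrict_apply (hm E hE), smul_eq_mul, ← ofReal_measureReal (μ := μ) (s := E),
      ← ofReal_measureReal (μ := μ) (s := E ∩ A), ← ENNReal.ofReal_mul hc]
    exact ENNReal.ofReal_le_ofReal (h E hE)
  have hsmul : ∫ ω, f ω ∂(ENNReal.ofReal c • μ.trim hm) = c * ∫ ω, f ω ∂μ := by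
    rw [integral_smul_measure, ENNReal.toReal_ofReal hc, ← integral_trim hm hf, smul_eq_mul]
  rw [← hsmul, integral_trim (μ := μ.restrict A) hm hf]
  exact integral_mono_measure hle (Filter.Eventually.of_forall hf0)
    (h_int.restrict.trim hm hf)

end Measure

lemma gdeg_pos {V : Type} [Finite V] {H : SimpleGraph V} {u v : V} (h : H.Adj u v) : 0 < gdeg H u := by
  have : Nonempty {w // H.Adj u w} := ⟨⟨v, h⟩⟩
  exact Nat.card_pos

lemma two_mul_sub_le_sq_mul_one_div {s d : ℝ} (hd : 0 < d) : 2 * s - d ≤ s ^ 2 * (1 / d) := by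
  rw [mul_one_div, le_div_iff₀ hd]
  nlinarith [sq_nonneg (s - d)]

namespace EMLoadProcess

open MeasureTheory ProbabilityTheory

attribute [instance] EMLoadProcess.mΩ EMLoadProcess.isProb

variable {V : Type} [Fintype V] [DecidableEq V] (P : EMLoadProcess V)

/-- The event that `u` and `v` are adjacent at time `t`. -/
def adjEvent (t : ℕ) (u v : V) : Set P.Ω := {ω | (P.G t ω).Adj u v}

lemma measurableSet_hist_adjEvent (t : ℕ) (u v : V) :
    MeasurableSet[P.hist (t + 1)] (P.adjEvent t u v) :=
  P.meas_G t (show MeasurableSet[⊤] {H : SimpleGraph V | H.Adj u v} from trivial)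

lemma measurableSet_hist_graph_fiber (t : ℕ) (H : SimpleGraph V) :
    MeasurableSet[P.hist (t + 1)] (P.G t ⁻¹' {H}) :=
  P.meas_G t trivial

lemma measurableSet_graph_fiber (t : ℕ) (H : SimpleGraph V) : MeasurableSet (P.G t ⁻¹' {H}) :=
  P.hist_le _ _ (P.measurableSet_hist_graph_fiber t H)

lemma measurableSet_matching (t : ℕ) (S : Set (Sym2 V)) : MeasurableSet {ω | P.M t ω = S} :=
  P.hist_le _ _ (P.meas_M t (show MeasurableSet[⊤] {S} from trivial))

/-- The larger of the two conditional edge probabilities. -/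
def maxProb : ℝ := max P.p (1 - P.q)

/-- The smaller of the two conditional edge probabilities. -/
def minProb : ℝ := min P.p (1 - P.q)

lemma minProb_pos : 0 < P.minProb := lt_min P.p_pos (by linarith [P.q_lt_one])

lemma maxProb_pos : 0 < P.maxProb := lt_max_of_lt_left P.p_pos

lemma r_mul_minProb : P.r * P.minProb = P.maxProb := by
  have hp := P.p_pos
  have hq : 0 < 1 - P.q := by linarith [P.q_lt_one]
  rcases le_total P.p (1 - P.q) with h | h
  · have h1 : P.p / (1 - P.q) ≤ (1 - P.q) / P.p :=
      ((div_le_one hq).2 h).trans ((one_le_div hp).2 h)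
    rw [r, minProb, maxProb, max_eq_right h1, max_eq_right h, min_eq_left h]
    field_simp
  · have h1 : (1 - P.q) / P.p ≤ P.p / (1 - P.q) :=
      ((div_le_one hp).2 h).trans ((one_le_div hq).2 h)
    rw [r, minProb, maxProb, max_eq_left h1, max_eq_left h, min_eq_right h]
    field_simp

lemma one_le_r : 1 ≤ P.r := by
  have h1 : P.minProb ≤ P.maxProb := min_le_max
  rw [← P.r_mul_minProb] at h1
  exact le_of_mul_le_mul_right (by linarith) P.minProb_pos

/-- The conditional probability that `u` and `v` are adjacent one step after the graph `H`. -/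
def edgeProb (H : SimpleGraph V) (u v : V) : ℝ :=
  open Classical in if H.Adj u v then 1 - P.q else P.p

lemma minProb_le_edgeProb (H : SimpleGraph V) (u v : V) : P.minProb ≤ P.edgeProb H u v := by
  unfold edgeProb
  split_ifs
  exacts [min_le_right _ _, min_le_left _ _]

lemma edgeProb_le_maxProb (H : SimpleGraph V) (u v : V) : P.edgeProb H u v ≤ P.maxProb := by
  unfold edgeProb
  split_ifs
  exacts [le_max_right _ _, le_max_left _ _]

lemma edgeProb_pos (H : SimpleGraph V) (u v : V) : 0 < P.edgeProb H u v :=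
  P.minProb_pos.trans_le (P.minProb_le_edgeProb H u v)

lemma cond_adjEvent {t : ℕ} {H : SimpleGraph V} {E : Set P.Ω}
    (hE : MeasurableSet[P.hist (t + 1)] E) (hEH : E ⊆ P.G t ⁻¹' {H}) (h0 : P.μ E ≠ 0) {u v : V}
    (huv : u ≠ v) :
    ProbabilityTheory.cond P.μ E (P.adjEvent (t + 1) u v) =
      ENNReal.ofReal (P.edgeProb H u v) := by
  unfold edgeProb
  split_ifs with h
  · exact P.markov_edge t H E hE h0 hEH s(u, v) (by simpa using huv) h
  · exact P.markov_nonedge t H E hE h0 hEH s(u, v) (by simpa using huv) h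

lemma measureReal_inter_adjEvent {t : ℕ} {H : SimpleGraph V} {E : Set P.Ω}
    (hE : MeasurableSet[P.hist (t + 1)] E) (hEH : E ⊆ P.G t ⁻¹' {H}) {u v : V} (huv : u ≠ v) :
    P.μ.real (E ∩ P.adjEvent (t + 1) u v) = P.edgeProb H u v * P.μ.real E :=
  measureReal_inter_eq_of_cond_eq (P.hist_le _ _ hE) (P.edgeProb_pos H u v).le fun h0 =>
    P.cond_adjEvent hE hEH h0 huv

lemma measureReal_inter_two_adjEvent {t : ℕ} {H : SimpleGraph V} {E : Set P.Ω}
    (hE : MeasurableSet[P.hist (t + 1)] E) (hEH : E ⊆ P.G t ⁻¹' {H}) {u v w : V} (huv : u ≠ v)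
    (huw : u ≠ w) (hvw : v ≠ w) :
    P.μ.real (E ∩ (P.adjEvent (t + 1) u v ∩ P.adjEvent (t + 1) u w)) =
      P.edgeProb H u v * P.edgeProb H u w * P.μ.real E := by
  refine measureReal_inter_eq_of_cond_eq (P.hist_le _ _ hE)
    (mul_pos (P.edgeProb_pos H u v) (P.edgeProb_pos H u w)).le fun h0 => ?_
  have hind := P.markov_indep t H E hE h0 hEH
  have hne : (⟨s(u, v), by simpa using huv⟩ : {e : Sym2 V // ¬e.IsDiag}) ≠
      ⟨s(u, w), by simpa using huw⟩ := by
    simp only [ne_eq, Subtype.mk.injEq, Sym2.eq_iff]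
    tauto
  have := hind.meas_biInter {⟨s(u, v), by simpa using huv⟩, ⟨s(u, w), by simpa using huw⟩}
  rw [prod_pair hne] at this
  simp only [mem_insert, mem_singleton, Set.iInter_iInter_eq_or_left,
    Set.iInter_iInter_eq_left, SimpleGraph.mem_edgeSet] at this
  rw [ENNReal.ofReal_mul (P.edgeProb_pos H u v).le, ← P.cond_adjEvent hE hEH h0 huv,
    ← P.cond_adjEvent hE hEH h0 huw]
  exact this

lemma minProb_mul_le_measureReal_inter_adjEvent {t : ℕ} {E : Set P.Ω}
    (hE : MeasurableSet[P.hist (t + 1)] E) {u v : V} (huv : u ≠ v) :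
    P.minProb * P.μ.real E ≤ P.μ.real (E ∩ P.adjEvent (t + 1) u v) := by
  rw [← one_mul (P.μ.real (E ∩ _))]
  refine mul_measureReal_le_of_fiber (P.measurableSet_graph_fiber t) fun H => ?_
  rw [Set.inter_right_comm, P.measureReal_inter_adjEvent
    (hE.inter (P.measurableSet_hist_graph_fiber t H)) Set.inter_subset_right huv, one_mul]
  exact mul_le_mul_of_nonneg_right (P.minProb_le_edgeProb H u v) measureReal_nonneg

lemma measureReal_inter_two_adjEvent_le {t : ℕ} {E : Set P.Ω}
    (hE : MeasurableSet[P.hist (t + 1)] E) {u v w : V} (huv : u ≠ v) (huw : u ≠ w) (hvw : v ≠ w) :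
    P.μ.real (E ∩ (P.adjEvent (t + 1) u v ∩ P.adjEvent (t + 1) u w)) ≤
      P.maxProb * P.μ.real (E ∩ P.adjEvent (t + 1) u v) := by
  rw [← one_mul (P.μ.real (E ∩ (_ ∩ _)))]
  refine mul_measureReal_le_of_fiber (P.measurableSet_graph_fiber t) fun H => ?_
  have hEH := hE.inter (P.measurableSet_hist_graph_fiber t H)
  rw [Set.inter_right_comm, Set.inter_right_comm E (P.adjEvent (t + 1) u v),
    P.measureReal_inter_adjEvent hEH Set.inter_subset_right huv,
    P.measureReal_inter_two_adjEvent hEH Set.inter_subset_right huv huw hvw, one_mul]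
  have h1 := P.edgeProb_le_maxProb H u w
  have h2 : 0 ≤ P.edgeProb H u v * P.μ.real (E ∩ P.G t ⁻¹' {H}) :=
    mul_nonneg (P.edgeProb_pos H u v).le measureReal_nonneg
  nlinarith

/-- An upper bound for the conditional mean degree of a vertex given one incident edge. -/
def degBound : ℝ := 1 + Fintype.card V * P.maxProb

lemma degBound_pos : 0 < P.degBound := by
  have := P.maxProb_pos
  unfold degBound
  positivity

lemma sum_measureReal_inter_two_adjEvent_le {t : ℕ} {E : Set P.Ω}
    (hE : MeasurableSet[P.hist (t + 1)] E) {u v : V} (huv : u ≠ v) :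
    ∑ w, P.μ.real (E ∩ (P.adjEvent (t + 1) u v ∩ P.adjEvent (t + 1) u w)) ≤
      P.degBound * P.μ.real (E ∩ P.adjEvent (t + 1) u v) := by
  have hX : 0 ≤ P.μ.real (E ∩ P.adjEvent (t + 1) u v) := measureReal_nonneg
  have hb : 0 ≤ P.maxProb * P.μ.real (E ∩ P.adjEvent (t + 1) u v) :=
    mul_nonneg P.maxProb_pos.le hX
  have hterm (w : V) : P.μ.real (E ∩ (P.adjEvent (t + 1) u v ∩ P.adjEvent (t + 1) u w)) ≤
      (if v = w then P.μ.real (E ∩ P.adjEvent (t + 1) u v) else 0) +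
        P.maxProb * P.μ.real (E ∩ P.adjEvent (t + 1) u v) := by
    split_ifs with hvw
    · subst hvw
      rw [Set.inter_self]
      linarith
    · rw [zero_add]
      by_cases huw : u = w
      · subst huw
        have : P.adjEvent (t + 1) u u = ∅ := by simp [adjEvent]
        simpa [this] using hb
      · exact P.measureReal_inter_two_adjEvent_le hE huv huw hvw
  refine (sum_le_sum fun w _ => hterm w).trans_eq ?_
  rw [sum_add_distrib, sum_ite_eq, if_pos (mem_univ _), sum_const, card_univ, nsmul_eq_mul,
    degBound]
  ring

lemma gdeg_mul_measureReal (t : ℕ) (E : Set P.Ω) (H : SimpleGraph V) (u : V) :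
    gdeg H u * P.μ.real (E ∩ P.G t ⁻¹' {H}) =
      ∑ w, P.μ.real (E ∩ P.adjEvent t u w ∩ P.G t ⁻¹' {H}) := by
  classical
  have hterm (w : V) : P.μ.real (E ∩ P.adjEvent t u w ∩ P.G t ⁻¹' {H}) =
      if H.Adj u w then P.μ.real (E ∩ P.G t ⁻¹' {H}) else 0 := by
    split_ifs with h
    · congr 1
      ext ω
      simp only [adjEvent, Set.mem_inter_iff, Set.mem_ofPred_eq, Set.mem_preimage,
        Set.mem_singleton_iff]
      constructor
      · rintro ⟨⟨h1, -⟩, h2⟩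
        exact ⟨h1, h2⟩
      · rintro ⟨h1, h2⟩
        exact ⟨⟨h1, h2 ▸ h⟩, h2⟩
    · convert measureReal_empty
      rw [Set.eq_empty_iff_forall_notMem]
      rintro ω ⟨⟨-, h1⟩, h2⟩
      exact h (h2 ▸ h1)
  simp only [hterm, gdeg, Nat.card_eq_fintype_card, Fintype.card_subtype, ← sum_filter, sum_const,
    nsmul_eq_mul]

lemma SimpleLB.measureReal_matching {P : EMLoadProcess V} (hP : P.SimpleLB) {t : ℕ} {E : Set P.Ω}
    (hE : MeasurableSet[P.hist t] E) {H : SimpleGraph V} {u v : V} (h : H.Adj u v) :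
    P.μ.real (E ∩ {ω | P.M t ω = {s(u, v)}} ∩ P.G t ⁻¹' {H}) =
      1 / (Fintype.card V : ℝ) * (1 / (gdeg H u : ℝ) + 1 / (gdeg H v : ℝ)) *
        P.μ.real (E ∩ P.G t ⁻¹' {H}) := by
  have h1 := measureReal_inter_eq_of_cond_eq (μ := P.μ)
    ((P.measurableSet_graph_fiber t H).inter (P.hist_le _ _ hE))
    (by positivity) (hP.2 t H u v h E hE)
  rw [Set.inter_right_comm, Set.inter_comm E (P.G t ⁻¹' {H})]
  exact h1

lemma SimpleLB.adjEvent_fiber_le {P : EMLoadProcess V} [Nonempty V] (hP : P.SimpleLB) {t : ℕ}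
    {E : Set P.Ω} (hE : MeasurableSet[P.hist t] E) (u v : V) (H : SimpleGraph V) (s : ℝ) :
    4 * s * P.μ.real (E ∩ P.adjEvent t u v ∩ P.G t ⁻¹' {H}) ≤
      s ^ 2 * Fintype.card V * P.μ.real (E ∩ {ω | P.M t ω = {s(u, v)}} ∩ P.G t ⁻¹' {H}) +
      (∑ w, P.μ.real (E ∩ (P.adjEvent t u v ∩ P.adjEvent t u w) ∩ P.G t ⁻¹' {H}) +
        ∑ w, P.μ.real (E ∩ (P.adjEvent t v u ∩ P.adjEvent t v w) ∩ P.G t ⁻¹' {H})) := by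
  have hsymm : P.adjEvent t v u = P.adjEvent t u v := by
    ext ω; exact SimpleGraph.adj_comm _ _ _
  by_cases h : H.Adj u v
  · have hadj : E ∩ P.adjEvent t u v ∩ P.G t ⁻¹' {H} = E ∩ P.G t ⁻¹' {H} := by
      ext ω
      simp only [adjEvent, Set.mem_inter_iff, Set.mem_ofPred_eq, Set.mem_preimage,
        Set.mem_singleton_iff]
      constructor
      · rintro ⟨⟨h1, -⟩, h2⟩
        exact ⟨h1, h2⟩
      · rintro ⟨h1, h2⟩
        exact ⟨⟨h1, h2 ▸ h⟩, h2⟩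
    have hdeg (x : V) := P.gdeg_mul_measureReal t (E ∩ P.adjEvent t u v) H x
    rw [hadj] at hdeg
    simp only [Set.inter_assoc E (P.adjEvent t u v)] at hdeg
    rw [hsymm, ← hdeg u, ← hdeg v, hadj, hP.measureReal_matching hE h]
    have hn : (Fintype.card V : ℝ) ≠ 0 := by simp
    have hu := two_mul_sub_le_sq_mul_one_div (s := s)
      (Nat.cast_pos.2 (gdeg_pos h) : (0 : ℝ) < gdeg H u)
    have hv := two_mul_sub_le_sq_mul_one_div (s := s)
      (Nat.cast_pos.2 (gdeg_pos h.symm) : (0 : ℝ) < gdeg H v)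
    have hX : 0 ≤ P.μ.real (E ∩ P.G t ⁻¹' {H}) := measureReal_nonneg
    have hcancel : s ^ 2 * Fintype.card V * (1 / (Fintype.card V : ℝ) *
        (1 / (gdeg H u : ℝ) + 1 / (gdeg H v : ℝ)) * P.μ.real (E ∩ P.G t ⁻¹' {H})) =
        (s ^ 2 * (1 / (gdeg H u : ℝ)) + s ^ 2 * (1 / (gdeg H v : ℝ))) *
          P.μ.real (E ∩ P.G t ⁻¹' {H}) := by
      field_simp
    rw [hcancel]
    nlinarith [mul_le_mul_of_nonneg_right hu hX, mul_le_mul_of_nonneg_right hv hX]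
  · have hempty : E ∩ P.adjEvent t u v ∩ P.G t ⁻¹' {H} = ∅ := by
      rw [Set.eq_empty_iff_forall_notMem]
      rintro ω ⟨⟨-, h1⟩, h2⟩
      exact h (h2 ▸ h1)
    rw [hempty, measureReal_empty, mul_zero]
    have hnn (F : Set P.Ω) : 0 ≤ P.μ.real F := measureReal_nonneg
    have := sum_nonneg fun w (_ : w ∈ univ) =>
      hnn (E ∩ (P.adjEvent t u v ∩ P.adjEvent t u w) ∩ P.G t ⁻¹' {H})
    have := sum_nonneg fun w (_ : w ∈ univ) =>
      hnn (E ∩ (P.adjEvent t v u ∩ P.adjEvent t v w) ∩ P.G t ⁻¹' {H})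
    have := hnn (E ∩ {ω | P.M t ω = {s(u, v)}} ∩ P.G t ⁻¹' {H})
    positivity

/-- A lower bound for the conditional probability that a given pair is matched. -/
def matchRate : ℝ := 2 * P.minProb / (Fintype.card V * P.degBound)

lemma SimpleLB.matchRate_mul_le {P : EMLoadProcess V} [Nonempty V] (hP : P.SimpleLB) {t : ℕ}
    {E : Set P.Ω} (hE : MeasurableSet[P.hist (t + 1)] E) {u v : V} (huv : u ≠ v) :
    P.matchRate * P.μ.real E ≤ P.μ.real (E ∩ {ω | P.M (t + 1) ω = {s(u, v)}}) := by
  have := Fintype.ofFinite (SimpleGraph V)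
  have hsymm : P.adjEvent (t + 1) v u = P.adjEvent (t + 1) u v := by
    ext ω; exact SimpleGraph.adj_comm _ _ _
  have hfib (F : Set P.Ω) : ∑ H, P.μ.real (F ∩ P.G (t + 1) ⁻¹' {H}) = P.μ.real F :=
    (measureReal_eq_sum_inter_fiber (P.measurableSet_graph_fiber (t + 1)) F).symm
  have hsum := sum_le_sum fun H (_ : H ∈ univ) => hP.adjEvent_fiber_le hE u v H P.degBound
  simp only [sum_add_distrib, ← mul_sum] at hsum
  rw [sum_comm, sum_comm (f := fun H w => P.μ.real
    (E ∩ (P.adjEvent (t + 1) v u ∩ P.adjEvent (t + 1) v w) ∩ P.G (t + 1) ⁻¹' {H}))] at hsum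
  simp only [hfib] at hsum
  have h1 := P.sum_measureReal_inter_two_adjEvent_le hE huv
  have h2 := P.sum_measureReal_inter_two_adjEvent_le hE huv.symm
  have h3 := P.minProb_mul_le_measureReal_inter_adjEvent hE huv
  rw [hsymm] at h2 hsum
  have hs := P.degBound_pos
  have hn : (0 : ℝ) < Fintype.card V := by exact_mod_cast Fintype.card_pos
  rw [matchRate, div_mul_eq_mul_div, div_le_iff₀ (by positivity)]
  refine le_of_mul_le_mul_left ?_ hs
  nlinarith [mul_le_mul_of_nonneg_left h3 hs.le]

lemma sum_load_succ_of_matching_eq {t : ℕ} {ω : P.Ω} {u v : V} (h : P.M t ω = {s(u, v)})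
    (f : ℕ → ℤ) :
    ∑ w, f (P.Γ (t + 1) ω w) + f (P.Γ t ω u) + f (P.Γ t ω v) =
      ∑ w, f (P.Γ t ω w) + f ((P.Γ t ω u + P.Γ t ω v + 1) / 2) +
        f ((P.Γ t ω u + P.Γ t ω v) / 2) := by
  have hmem : s(u, v) ∈ P.M t ω := by simp [h]
  have huv : u ≠ v := (P.M_sub t ω hmem).ne
  have hother (w : V) (hw : w ∉ ({u, v} : Finset V)) : P.Γ (t + 1) ω w = P.Γ t ω w := by
    refine P.unmatched t ω w fun x hx => ?_
    rw [h, Set.mem_singleton_iff, Sym2.eq_iff] at hx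
    simp only [mem_insert, mem_singleton] at hw
    tauto
  have hdiff : ∑ w, (f (P.Γ (t + 1) ω w) - f (P.Γ t ω w)) =
      (f (P.Γ (t + 1) ω u) - f (P.Γ t ω u)) + (f (P.Γ (t + 1) ω v) - f (P.Γ t ω v)) := by
    rw [← sum_pair (f := fun w => f (P.Γ (t + 1) ω w) - f (P.Γ t ω w)) huv]
    exact (sum_subset (subset_univ _) fun w _ hw => by rw [hother w hw, sub_self]).symm
  rw [sum_sub_distrib] at hdiff
  rcases P.matched t ω u v hmem with ⟨h1, h2⟩ | ⟨h1, h2⟩ <;> rw [h1, h2] at hdiff <;> linarith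

lemma load_succ_of_matching_eq_empty {t : ℕ} {ω : P.Ω} (h : P.M t ω = ∅) :
    P.Γ (t + 1) ω = P.Γ t ω :=
  funext fun v => P.unmatched t ω v fun u => by simp [h]

variable {P}

lemma SimpleLB.matching_eq_empty_or_singleton (hP : P.SimpleLB) (t : ℕ) (ω : P.Ω) :
    P.M t ω = ∅ ∨ ∃ u v, P.M t ω = {s(u, v)} := by
  rcases (hP.1 t ω).eq_empty_or_singleton with h | ⟨e, he⟩
  · exact Or.inl h
  · induction e with
    | _ u v => exact Or.inr ⟨u, v, he⟩

lemma SimpleLB.sum_load_succ (hP : P.SimpleLB) (t : ℕ) (ω : P.Ω) :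
    ∑ v, (P.Γ (t + 1) ω v : ℤ) = ∑ v, (P.Γ t ω v : ℤ) := by
  rcases hP.matching_eq_empty_or_singleton t ω with h | ⟨u, v, h⟩
  · rw [P.load_succ_of_matching_eq_empty h]
  · have := P.sum_load_succ_of_matching_eq h (fun k => (k : ℤ))
    omega

lemma SimpleLB.sum_load (hP : P.SimpleLB) (t : ℕ) (ω : P.Ω) :
    ∑ v, (P.Γ t ω v : ℤ) = ∑ v, (P.Γ 0 ω v : ℤ) := by
  induction t with
  | zero => rfl
  | succ t ih => rw [hP.sum_load_succ, ih]

lemma totalSpread_succ_of_matching_eq {t : ℕ} {ω : P.Ω} {u v : V} (h : P.M t ω = {s(u, v)})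
    (m : ℤ) :
    totalSpread m (P.Γ (t + 1) ω) + pairDrop m (P.Γ t ω) u v = totalSpread m (P.Γ t ω) := by
  have := P.sum_load_succ_of_matching_eq h (fun k => spread (k - m))
  have h1 : (((P.Γ t ω u + P.Γ t ω v + 1) / 2 : ℕ) : ℤ) - m =
      (P.Γ t ω u - m + (P.Γ t ω v - m) + 1) / 2 := by omega
  have h2 : (((P.Γ t ω u + P.Γ t ω v) / 2 : ℕ) : ℤ) - m =
      (P.Γ t ω u - m + (P.Γ t ω v - m)) / 2 := by omega
  rw [h1, h2] at this
  unfold totalSpread pairDrop spreadDrop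
  linarith

lemma SimpleLB.totalSpread_succ_add_le (hP : P.SimpleLB) (m : ℤ) (t : ℕ) (ω : P.Ω) :
    2 * (totalSpread m (P.Γ (t + 1) ω) : ℝ) +
      ∑ u, ∑ v, {ω | P.M t ω = {s(u, v)}}.indicator
        (fun ω => (pairDrop m (P.Γ t ω) u v : ℝ)) ω ≤ 2 * totalSpread m (P.Γ t ω) := by
  classical
  rcases hP.matching_eq_empty_or_singleton t ω with h | ⟨a, b, h⟩
  · simp [Set.indicator, h, P.load_succ_of_matching_eq_empty h, (Set.singleton_ne_empty _).symm]
  · have hterm (u v : V) : {ω | P.M t ω = {s(u, v)}}.indicator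
        (fun ω => (pairDrop m (P.Γ t ω) u v : ℝ)) ω ≤
        (if a = u then if b = v then (pairDrop m (P.Γ t ω) u v : ℝ) else 0 else 0) +
        (if b = u then if a = v then (pairDrop m (P.Γ t ω) u v : ℝ) else 0 else 0) := by
      have h0 : (0 : ℝ) ≤ pairDrop m (P.Γ t ω) u v := by exact_mod_cast pairDrop_nonneg m _ u v
      simp only [Set.indicator, Set.mem_ofPred_eq, h, Set.singleton_eq_singleton_iff, Sym2.eq_iff]
      split_ifs <;> first | linarith | (exfalso; tauto)
    have hsum := sum_le_sum fun u (_ : u ∈ univ) => sum_le_sum fun v (_ : v ∈ univ) => hterm u v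
    simp only [sum_add_distrib, sum_ite_eq, mem_univ, if_true, sum_ite_irrel,
      sum_const_zero] at hsum
    have hcomm : pairDrop m (P.Γ t ω) b a = pairDrop m (P.Γ t ω) a b := spreadDrop_comm _ _
    rw [hcomm] at hsum
    have : (totalSpread m (P.Γ (t + 1) ω) : ℝ) + pairDrop m (P.Γ t ω) a b =
        totalSpread m (P.Γ t ω) := by
      exact_mod_cast totalSpread_succ_of_matching_eq h m
    linarith

lemma SimpleLB.totalSpread_succ_le (hP : P.SimpleLB) (m : ℤ) (t : ℕ) (ω : P.Ω) :
    totalSpread m (P.Γ (t + 1) ω) ≤ totalSpread m (P.Γ t ω) := by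
  rcases hP.matching_eq_empty_or_singleton t ω with h | ⟨a, b, h⟩
  · rw [P.load_succ_of_matching_eq_empty h]
  · linarith [totalSpread_succ_of_matching_eq h m, pairDrop_nonneg m (P.Γ t ω) a b]

lemma SimpleLB.totalSpread_le (hP : P.SimpleLB) (m : ℤ) (t : ℕ) (ω : P.Ω) :
    totalSpread m (P.Γ t ω) ≤ totalSpread m (P.Γ 0 ω) := by
  induction t with
  | zero => rfl
  | succ t ih => exact (hP.totalSpread_succ_le m t ω).trans ih

variable (P) in
lemma stronglyMeasurable_load (t : ℕ) (F : (V → ℕ) → ℝ) :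
    StronglyMeasurable[P.hist t] fun ω => F (P.Γ t ω) := by
  refine Measurable.stronglyMeasurable ?_
  exact @Measurable.comp _ _ _ (P.hist t) ⊤ _ F (P.Γ t) measurable_from_top (P.meas_Γ t)

variable {m : ℤ} {Γ₀ : V → ℕ}

lemma SimpleLB.integrable_totalSpread (hP : P.SimpleLB) (h0 : ∀ ω, P.Γ 0 ω = Γ₀) (m : ℤ)
    (t : ℕ) : Integrable (fun ω => (totalSpread m (P.Γ t ω) : ℝ)) P.μ := by
  refine Integrable.of_bound (((P.stronglyMeasurable_load t
    fun γ => (totalSpread m γ : ℝ)).mono (P.hist_le t)).aestronglyMeasurable)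
    (totalSpread m Γ₀ : ℝ) (Filter.Eventually.of_forall fun ω => ?_)
  have h1 := hP.totalSpread_le m t ω
  rw [h0] at h1
  rw [Real.norm_of_nonneg (by exact_mod_cast totalSpread_nonneg m _)]
  exact_mod_cast h1

lemma SimpleLB.integrable_pairDrop (hP : P.SimpleLB) (h0 : ∀ ω, P.Γ 0 ω = Γ₀) (m : ℤ)
    (t : ℕ) (u v : V) : Integrable (fun ω => (pairDrop m (P.Γ t ω) u v : ℝ)) P.μ := by
  refine ((hP.integrable_totalSpread h0 m t).const_mul 2).mono' (((P.stronglyMeasurable_load t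
    fun γ => (pairDrop m γ u v : ℝ)).mono (P.hist_le t)).aestronglyMeasurable)
    (Filter.Eventually.of_forall fun ω => ?_)
  rw [Real.norm_of_nonneg (by exact_mod_cast pairDrop_nonneg m _ u v)]
  exact_mod_cast pairDrop_le m _ u v

lemma matchRate_nonneg : 0 ≤ P.matchRate := by
  have := P.minProb_pos
  have := P.degBound_pos
  unfold matchRate
  positivity

lemma SimpleLB.matchRate_mul_integral_le [Nonempty V] (hP : P.SimpleLB)
    (h0 : ∀ ω, P.Γ 0 ω = Γ₀) (m : ℤ) (t : ℕ) (u v : V) :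
    P.matchRate * ∫ ω, (pairDrop m (P.Γ (t + 1) ω) u v : ℝ) ∂P.μ ≤
      ∫ ω in {ω | P.M (t + 1) ω = {s(u, v)}}, (pairDrop m (P.Γ (t + 1) ω) u v : ℝ) ∂P.μ := by
  rcases eq_or_ne u v with rfl | huv
  · simp [pairDrop, spreadDrop_self]
  · exact mul_integral_le_setIntegral (P.hist_le _) matchRate_nonneg
      (fun E hE => hP.matchRate_mul_le hE huv)
      (P.stronglyMeasurable_load (t + 1) fun γ => (pairDrop m γ u v : ℝ))
      (fun ω => Int.cast_nonneg (pairDrop_nonneg m _ u v)) (hP.integrable_pairDrop h0 m _ u v)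

lemma SimpleLB.card_mul_totalSpread_le (hP : P.SimpleLB) (h0 : ∀ ω, P.Γ 0 ω = Γ₀)
    (hm : |2 * ∑ v, ((Γ₀ v : ℤ) - m)| ≤ Fintype.card V) (t : ℕ) (ω : P.Ω) :
    Fintype.card V * totalSpread m (P.Γ t ω) ≤
      16 * ∑ u, ∑ v, pairDrop m (P.Γ t ω) u v := by
  refine card_mul_sum_spread_le (fun v => (P.Γ t ω v : ℤ) - m) ?_
  rw [sum_sub_distrib, hP.sum_load, h0, ← sum_sub_distrib]
  exact hm

lemma SimpleLB.integral_totalSpread_succ_le [Nonempty V] (hP : P.SimpleLB)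
    (h0 : ∀ ω, P.Γ 0 ω = Γ₀) (hm : |2 * ∑ v, ((Γ₀ v : ℤ) - m)| ≤ Fintype.card V) (t : ℕ) :
    ∫ ω, (totalSpread m (P.Γ (t + 2) ω) : ℝ) ∂P.μ ≤
      (1 - P.matchRate * Fintype.card V / 32) *
        ∫ ω, (totalSpread m (P.Γ (t + 1) ω) : ℝ) ∂P.μ := by
  have hA (u v : V) : MeasurableSet {ω | P.M (t + 1) ω = {s(u, v)}} := P.measurableSet_matching _ _
  have h_int (u v : V) := hP.integrable_pairDrop h0 m (t + 1) u v
  have hind (u v : V) := (h_int u v).indicator (hA u v)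
  have hS (t : ℕ) := hP.integrable_totalSpread h0 m t
  have h1 : 2 * ∫ ω, (totalSpread m (P.Γ (t + 2) ω) : ℝ) ∂P.μ +
      ∑ u, ∑ v, ∫ ω in {ω | P.M (t + 1) ω = {s(u, v)}},
        (pairDrop m (P.Γ (t + 1) ω) u v : ℝ) ∂P.μ ≤
      2 * ∫ ω, (totalSpread m (P.Γ (t + 1) ω) : ℝ) ∂P.μ := by
    have := integral_mono (μ := P.μ) (((hS (t + 2)).const_mul 2).add
      (integrable_finsetSum univ fun u _ => integrable_finsetSum univ fun v _ => hind u v))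
      ((hS (t + 1)).const_mul 2) (hP.totalSpread_succ_add_le m (t + 1))
    simp only [Pi.add_apply] at this
    rw [integral_add ((hS (t + 2)).const_mul 2) (integrable_finsetSum univ fun u _ =>
      integrable_finsetSum univ fun v _ => hind u v), integral_const_mul, integral_const_mul,
      integral_finsetSum _ fun u _ => integrable_finsetSum univ fun v _ => hind u v] at this
    simp only [integral_finsetSum _ fun v _ => hind _ v, integral_indicator (hA _ _)] at this
    exact this
  have h2 : P.matchRate * ∑ u, ∑ v, ∫ ω, (pairDrop m (P.Γ (t + 1) ω) u v : ℝ) ∂P.μ ≤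
      ∑ u, ∑ v, ∫ ω in {ω | P.M (t + 1) ω = {s(u, v)}},
        (pairDrop m (P.Γ (t + 1) ω) u v : ℝ) ∂P.μ := by
    simp only [mul_sum]
    exact sum_le_sum fun u _ => sum_le_sum fun v _ => hP.matchRate_mul_integral_le h0 m t u v
  have h3 : Fintype.card V * ∫ ω, (totalSpread m (P.Γ (t + 1) ω) : ℝ) ∂P.μ ≤
      16 * ∑ u, ∑ v, ∫ ω, (pairDrop m (P.Γ (t + 1) ω) u v : ℝ) ∂P.μ := by
    simp only [← integral_finsetSum _ fun v _ => h_int _ v]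
    rw [← integral_finsetSum _ fun u _ => integrable_finsetSum univ fun v _ => h_int u v,
      ← integral_const_mul, ← integral_const_mul]
    refine integral_mono ((hS (t + 1)).const_mul _) ((integrable_finsetSum univ fun u _ =>
      integrable_finsetSum univ fun v _ => h_int u v).const_mul _) fun ω => ?_
    exact_mod_cast hP.card_mul_totalSpread_le h0 hm (t + 1) ω
  have h4 := mul_le_mul_of_nonneg_left h3 (matchRate_nonneg (P := P))
  linarith

lemma SimpleLB.integral_totalSpread_le [Nonempty V] (hP : P.SimpleLB)
    (h0 : ∀ ω, P.Γ 0 ω = Γ₀) (hm : |2 * ∑ v, ((Γ₀ v : ℤ) - m)| ≤ Fintype.card V) (t : ℕ) :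
    ∫ ω, (totalSpread m (P.Γ (t + 1) ω) : ℝ) ∂P.μ ≤
      Real.exp (-(P.matchRate * Fintype.card V / 32 * t)) * totalSpread m Γ₀ := by
  induction t with
  | zero =>
    have := integral_mono (hP.integrable_totalSpread h0 m 1) (integrable_const _) fun ω =>
      (by exact_mod_cast h0 ω ▸ hP.totalSpread_succ_le m 0 ω :
        (totalSpread m (P.Γ 1 ω) : ℝ) ≤ totalSpread m Γ₀)
    simpa using this
  | succ t ih =>
    have hnn : 0 ≤ ∫ ω, (totalSpread m (P.Γ (t + 1) ω) : ℝ) ∂P.μ :=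
      integral_nonneg fun ω => Int.cast_nonneg (totalSpread_nonneg m _)
    calc ∫ ω, (totalSpread m (P.Γ (t + 2) ω) : ℝ) ∂P.μ
        ≤ (1 - P.matchRate * Fintype.card V / 32) *
            ∫ ω, (totalSpread m (P.Γ (t + 1) ω) : ℝ) ∂P.μ :=
          hP.integral_totalSpread_succ_le h0 hm t
      _ ≤ Real.exp (-(P.matchRate * Fintype.card V / 32)) *
            ∫ ω, (totalSpread m (P.Γ (t + 1) ω) : ℝ) ∂P.μ := by
          refine mul_le_mul_of_nonneg_right ?_ hnn
          linarith [Real.add_one_le_exp (-(P.matchRate * Fintype.card V / 32))]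
      _ ≤ Real.exp (-(P.matchRate * Fintype.card V / 32)) *
            (Real.exp (-(P.matchRate * Fintype.card V / 32 * t)) * totalSpread m Γ₀) :=
          mul_le_mul_of_nonneg_left ih (Real.exp_pos _).le
      _ = _ := by
          rw [← mul_assoc, ← Real.exp_add]
          push_cast
          ring_nf

lemma SimpleLB.le_measureReal_balanced [Nonempty V] (hP : P.SimpleLB)
    (h0 : ∀ ω, P.Γ 0 ω = Γ₀) (hm : |2 * ∑ v, ((Γ₀ v : ℤ) - m)| ≤ Fintype.card V) (t : ℕ) :
    1 - Real.exp (-(P.matchRate * Fintype.card V / 32 * t)) * totalSpread m Γ₀ ≤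
      P.μ.real {ω | ∀ v, |(P.Γ (t + 1) ω v : ℤ) - m| ≤ 1} := by
  have hmarkov := mul_meas_ge_le_integral_of_nonneg (μ := P.μ)
    (Filter.Eventually.of_forall fun ω => (by exact_mod_cast totalSpread_nonneg m _ :
      (0 : ℝ) ≤ totalSpread m (P.Γ (t + 1) ω))) (hP.integrable_totalSpread h0 m (t + 1)) 1
  have hcompl : {ω | (1 : ℝ) ≤ totalSpread m (P.Γ (t + 1) ω)}ᶜ =
      {ω | ∀ v, |(P.Γ (t + 1) ω v : ℤ) - m| ≤ 1} := by
    ext ω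
    rw [Set.mem_ofPred_eq, ← totalSpread_eq_zero_iff, Set.mem_compl_iff, Set.mem_ofPred_eq]
    have := totalSpread_nonneg m (P.Γ (t + 1) ω)
    norm_cast
    omega
  have hmeas : MeasurableSet {ω | (1 : ℝ) ≤ totalSpread m (P.Γ (t + 1) ω)} :=
    measurableSet_le measurable_const
      ((P.stronglyMeasurable_load (t + 1) fun γ => (totalSpread m γ : ℝ)).mono
        (P.hist_le _)).measurable
  rw [← hcompl, probReal_compl_eq_one_sub hmeas]
  linarith [hP.integral_totalSpread_le h0 hm t]

lemma le_matchRate_mul_card [Nonempty V] {θ : ℝ} (hθ : 0 < θ)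
    (h : θ / (Fintype.card V : ℝ) ≤ max P.p (1 - P.q)) :
    2 * (θ / (1 + θ)) / (P.r * Fintype.card V) ≤ P.matchRate * Fintype.card V := by
  have hn : (0 : ℝ) < Fintype.card V := by exact_mod_cast Fintype.card_pos
  have hr := zero_lt_one.trans_le P.one_le_r
  have hmin := P.minProb_pos
  have hs := P.degBound_pos
  have hmax : θ ≤ Fintype.card V * P.maxProb := by
    rw [div_le_iff₀ hn] at h
    unfold maxProb
    linarith
  have hrate : P.matchRate * Fintype.card V = 2 * P.minProb / P.degBound := by
    unfold matchRate
    field_simp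
  rw [hrate, mul_div_assoc', div_div, div_le_div_iff₀ (by positivity) hs]
  have : 2 * P.minProb * ((1 + θ) * (P.r * Fintype.card V)) =
      2 * ((1 + θ) * (Fintype.card V * P.maxProb)) := by
    rw [← P.r_mul_minProb]; ring
  rw [this, degBound]
  linarith

end EMLoadProcess

section Target

variable {V : Type} [Fintype V] [Nonempty V] (Γ₀ : V → ℕ)

lemma abs_two_mul_sum_sub_roundNear_le :
    |2 * ∑ v, ((Γ₀ v : ℤ) - roundNear (avgLoad Γ₀))| ≤ Fintype.card V := by
  have hn : (0 : ℝ) < Fintype.card V := by exact_mod_cast Fintype.card_pos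
  have h1 : avgLoad Γ₀ - 1 / 2 ≤ roundNear (avgLoad Γ₀) := Int.le_ceil _
  have h2 : (roundNear (avgLoad Γ₀) : ℝ) < avgLoad Γ₀ - 1 / 2 + 1 := Int.ceil_lt_add_one _
  have h3 : avgLoad Γ₀ * Fintype.card V = ∑ v, (Γ₀ v : ℝ) := div_mul_cancel₀ _ hn.ne'
  rw [sum_sub_distrib, sum_const, card_univ, nsmul_eq_mul, abs_le]
  constructor <;> rify <;> nlinarith

lemma abs_sub_roundNear_le_disc (v : V) :
    |(Γ₀ v : ℤ) - roundNear (avgLoad Γ₀)| ≤ disc Γ₀ := by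
  have hn : (0 : ℝ) < Fintype.card V := by exact_mod_cast Fintype.card_pos
  have hsup (w : V) : Γ₀ w ≤ univ.sup Γ₀ := le_sup (mem_univ w)
  have hinf (w : V) : univ.inf' univ_nonempty Γ₀ ≤ Γ₀ w := inf'_le _ (mem_univ w)
  have hup : roundNear (avgLoad Γ₀) ≤ univ.sup Γ₀ := by
    refine Int.ceil_le.2 ?_
    have : avgLoad Γ₀ ≤ univ.sup Γ₀ := by
      rw [avgLoad, div_le_iff₀ hn, mul_comm, ← nsmul_eq_mul, ← card_univ]
      exact sum_le_card_nsmul _ _ _ fun w _ => by exact_mod_cast hsup w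
    push_cast
    linarith
  have hlow : ((univ.inf' univ_nonempty Γ₀ : ℕ) : ℤ) ≤ roundNear (avgLoad Γ₀) := by
    refine Int.le_ceil_iff.2 ?_
    have : ((univ.inf' univ_nonempty Γ₀ : ℕ) : ℝ) ≤ avgLoad Γ₀ := by
      rw [avgLoad, le_div_iff₀ hn, mul_comm, ← nsmul_eq_mul, ← card_univ]
      exact card_nsmul_le_sum _ _ _ fun w _ => by exact_mod_cast hinf w
    rw [Int.cast_natCast]
    linarith
  have := hsup v
  have := hinf v
  unfold disc
  rw [abs_le]
  omega

lemma totalSpread_roundNear_le :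
    totalSpread (roundNear (avgLoad Γ₀)) Γ₀ ≤ Fintype.card V * (disc Γ₀ : ℤ) ^ 2 := by
  unfold totalSpread
  rw [← nsmul_eq_mul, ← card_univ]
  refine sum_le_card_nsmul _ _ _ fun v _ => (spread_le_sq _).trans ?_
  rw [← sq_abs]
  exact pow_le_pow_left₀ (abs_nonneg _) (abs_sub_roundNear_le_disc Γ₀ v) 2

end Target

/-- **Balancing time of the simple load-balancing algorithm (Theorem 2).**
Suppose `p ∈ (0,1]` and `q ∈ [0,1)` satisfy `max{p, 1−q} ≥ θ/n` for a constant `θ > 0`, and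
consider the simple load-balancing algorithm on an edge-Markovian evolving graph with
parameters `p, q`.  Then there is a constant `C > 0` such that for any initial configuration
`Γ₀`, with probability at least `1 − 1/n` the balancing time satisfies
`T_bal ≤ C·r·n·log(Δ·n)`, where `r = max{p/(1−q), (1−q)/p}`. -/
theorem simple_load_balancing_time (θ : ℝ) (hθ : 0 < θ) :
    ∃ C : ℝ, 0 < C ∧
      ∀ (V : Type) [Fintype V] [DecidableEq V] [Nonempty V],
        ∀ (P : EMLoadProcess V) (Γ₀ : V → ℕ),
          P.SimpleLB →
          θ / (Fintype.card V : ℝ) ≤ max P.p (1 - P.q) →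
          (∀ ω, P.Γ 0 ω = Γ₀) →
          ENNReal.ofReal (1 - 1 / (Fintype.card V : ℝ)) ≤
            P.μ {ω | ∃ t : ℕ,
              (t : ℝ) ≤ C * P.r * (Fintype.card V : ℝ) *
                Real.log ((disc Γ₀ : ℝ) * (Fintype.card V : ℝ)) ∧
              ∀ v : V, |(P.Γ t ω v : ℤ) - roundNear (avgLoad Γ₀)| ≤ 1} := by
  refine ⟨32 * (1 + θ) / θ + 2, by positivity, fun V _ _ _ P Γ₀ hP hmax h0 => ?_⟩
  have hn0 : (0 : ℝ) < Fintype.card V := by exact_mod_cast Fintype.card_pos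
  have hr := P.one_le_r
  rcases (Nat.succ_le_of_lt (Fintype.card_pos (α := V))).eq_or_lt with hn | hn
  · simp [← hn]
  rcases Nat.eq_zero_or_pos (disc Γ₀) with hd | hd
  · have hall : {ω | ∃ t : ℕ, (t : ℝ) ≤ (32 * (1 + θ) / θ + 2) * P.r * (Fintype.card V : ℝ) *
        Real.log ((disc Γ₀ : ℝ) * (Fintype.card V : ℝ)) ∧
        ∀ v : V, |(P.Γ t ω v : ℤ) - roundNear (avgLoad Γ₀)| ≤ 1} = Set.univ := by
      refine Set.eq_univ_of_forall fun ω => ⟨0, by simp [hd], fun v => ?_⟩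
      rw [h0]
      exact (abs_sub_roundNear_le_disc Γ₀ v).trans (by simp [hd])
    rw [hall, MeasureTheory.measure_univ]
    exact ENNReal.ofReal_le_one.2 (by linarith [one_div_pos.2 hn0])
  have hd' : (1 : ℝ) ≤ disc Γ₀ := by exact_mod_cast hd
  have hn' : (2 : ℝ) ≤ Fintype.card V := by exact_mod_cast hn
  set n : ℝ := (Fintype.card V : ℝ) with hndef
  set L := Real.log ((disc Γ₀ : ℝ) * n) with hL
  have hLpos : 1 / 2 ≤ L := by
    have h1 : Real.log 2 ≤ L := Real.log_le_log (by norm_num) (by nlinarith)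
    linarith [Real.log_two_gt_d9]
  set T := ⌈32 * (1 + θ) / θ * P.r * n * L⌉₊ with hT
  have hTle : ((T + 1 : ℕ) : ℝ) ≤ (32 * (1 + θ) / θ + 2) * P.r * n * L := by
    have h1 : (T : ℝ) < 32 * (1 + θ) / θ * P.r * n * L + 1 :=
      Nat.ceil_lt_add_one (by positivity)
    have h2 : 2 ≤ P.r * n := by nlinarith
    have h3 : 1 ≤ P.r * n * L := by nlinarith
    push_cast
    linarith
  have hexp : Real.exp (-(P.matchRate * n / 32 * T)) *
      totalSpread (roundNear (avgLoad Γ₀)) Γ₀ ≤ 1 / n := by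
    have hrate : 0 ≤ P.matchRate := EMLoadProcess.matchRate_nonneg
    have h1 : 2 * L ≤ P.matchRate * n / 32 * T := by
      have h2 := EMLoadProcess.le_matchRate_mul_card hθ hmax
      have h3 : 32 * (1 + θ) / θ * P.r * n * L ≤ T := Nat.le_ceil _
      calc 2 * L = 2 * (θ / (1 + θ)) / (P.r * n) / 32 * (32 * (1 + θ) / θ * P.r * n * L) := by
            field_simp
        _ ≤ _ := mul_le_mul (by linarith) h3 (by positivity) (by positivity)
    have h2 : (totalSpread (roundNear (avgLoad Γ₀)) Γ₀ : ℝ) ≤ n * (disc Γ₀ : ℝ) ^ 2 := by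
      rw [hndef]
      exact_mod_cast totalSpread_roundNear_le Γ₀
    have h3 : Real.exp (-(2 * L)) = (((disc Γ₀ : ℝ) * n) ^ 2)⁻¹ := by
      rw [Real.exp_neg, two_mul, Real.exp_add, Real.exp_log (by positivity), sq]
    calc Real.exp (-(P.matchRate * n / 32 * T)) * totalSpread (roundNear (avgLoad Γ₀)) Γ₀
        ≤ Real.exp (-(2 * L)) * (n * (disc Γ₀ : ℝ) ^ 2) := by
          have := totalSpread_nonneg (roundNear (avgLoad Γ₀)) Γ₀
          gcongr
      _ = 1 / n := by
          rw [h3]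
          field_simp
  have hbal := hP.le_measureReal_balanced h0 (abs_two_mul_sum_sub_roundNear_le Γ₀) T
  refine le_trans ?_ (MeasureTheory.measure_mono (μ := P.μ)
    (s := {ω | ∀ v, |(P.Γ (T + 1) ω v : ℤ) - roundNear (avgLoad Γ₀)| ≤ 1})
    fun ω hω => ⟨T + 1, hTle, hω⟩)
  rw [← MeasureTheory.ofReal_measureReal]
  exact ENNReal.ofReal_le_ofReal (by linarith)

end
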